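/- Let A be an invertible block matrix over a field 𝔽 with n block rows/columns admitting an SSS representation with dimensions (r^h_i) and (r^g_i). Then A⁻¹ admits an SSS representation with the same dimensions: r^h_{A⁻¹,i} = r^h_{A,i} and r^g_{A⁻¹,i} = r^g_{A,i} for all 1 ≤ i ≤ n−1. -/

import Mathlib

open Matrix

variable {𝔽 : Type*} [Field 𝔽]

/-- The product of `d` consecutive transition matrices `W k * W (k+1) * ⋯ * W (k+d-1)`. -/
def sssChainAux (rg : ℕ → ℕ) (W : ∀ j, Matrix (Fin (rg j)) (Fin (rg (j + 1))) 𝔽) (k : ℕ) :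
    (d : ℕ) → Matrix (Fin (rg k)) (Fin (rg (k + d))) 𝔽
  | 0 => (1 : Matrix (Fin (rg k)) (Fin (rg k)) 𝔽)
  | d + 1 => sssChainAux rg W k d * W (k + d)

/-- The product of the transition matrices `W k * W (k+1) * ⋯ * W (ℓ-1)` (the identity when
`k = ℓ`, and junk `0` when `ℓ < k`). -/
def sssChain (rg : ℕ → ℕ) (W : ∀ j, Matrix (Fin (rg j)) (Fin (rg (j + 1))) 𝔽) (k ℓ : ℕ) :
    Matrix (Fin (rg k)) (Fin (rg ℓ)) 𝔽 :=
  if h : k ≤ ℓ then Nat.add_sub_cancel' h ▸ sssChainAux rg W k (ℓ - k) else 0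

/-- A sequentially semi-separable (SSS) representation of a block matrix `A` (with `n` block
rows/columns, block `k` of size `N k`, blocks indexed from `0`) with dimensions `rg`, `rh`
(`rg c`, `rh c` being the state dimensions at the cut between blocks `c` and `c + 1`, for
`0 ≤ c ≤ n - 2`): the diagonal blocks of `A` are `D k`; the strictly upper blocks are
`A_{k ℓ} = U k * W k * W (k+1) * ⋯ * W (ℓ - 2) * (V ℓ)ᵀ` for `k < ℓ`; and the strictly lower
blocks are `A_{k ℓ} = P k * R (k-2) * R (k-3) * ⋯ * R ℓ * (Q ℓ)ᵀ` for `ℓ < k`. -/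
def IsSSSRep {n : ℕ} (N : ℕ → ℕ)
    (A : Matrix ((k : Fin n) × Fin (N k)) ((k : Fin n) × Fin (N k)) 𝔽)
    (rg rh : ℕ → ℕ)
    (U : ∀ k, Matrix (Fin (N k)) (Fin (rg k)) 𝔽)
    (W : ∀ j, Matrix (Fin (rg j)) (Fin (rg (j + 1))) 𝔽)
    (V : ∀ k, Matrix (Fin (N k)) (Fin (rg (k - 1))) 𝔽)
    (D : ∀ k, Matrix (Fin (N k)) (Fin (N k)) 𝔽)
    (P : ∀ k, Matrix (Fin (N k)) (Fin (rh (k - 1))) 𝔽)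
    (R : ∀ j, Matrix (Fin (rh (j + 1))) (Fin (rh j)) 𝔽)
    (Q : ∀ k, Matrix (Fin (N k)) (Fin (rh k)) 𝔽) : Prop :=
  (∀ (k : Fin n) (i j : Fin (N k)), A ⟨k, i⟩ ⟨k, j⟩ = D k i j) ∧
  (∀ (k ℓ : Fin n), (k : ℕ) < (ℓ : ℕ) → ∀ (i : Fin (N k)) (j : Fin (N ℓ)),
      A ⟨k, i⟩ ⟨ℓ, j⟩ = (U k * sssChain rg W k ((ℓ : ℕ) - 1) * (V ℓ)ᵀ) i j) ∧
  (∀ (k ℓ : Fin n), (ℓ : ℕ) < (k : ℕ) → ∀ (i : Fin (N k)) (j : Fin (N ℓ)),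
      A ⟨k, i⟩ ⟨ℓ, j⟩ =
        (P k * (sssChain rh (fun j => (R j)ᵀ) ℓ ((k : ℕ) - 1))ᵀ * (Q ℓ)ᵀ) i j)

/-- The lower Hankel block `𝓗` at cut `c`: rows in blocks `{c+1, …, n-1}`, columns in blocks
`{0, …, c}`. -/
def lowerHankelBlock {n : ℕ} (N : ℕ → ℕ)
    (A : Matrix ((k : Fin n) × Fin (N k)) ((k : Fin n) × Fin (N k)) 𝔽) (c : ℕ) :
    Matrix {p : (k : Fin n) × Fin (N k) // c < (p.1 : ℕ)}
      {p : (k : Fin n) × Fin (N k) // (p.1 : ℕ) ≤ c} 𝔽 :=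
  Matrix.of fun i j => A i.1 j.1

/-- The upper Hankel block `𝓖` at cut `c`: rows in blocks `{0, …, c}`, columns in blocks
`{c+1, …, n-1}`. -/
def upperHankelBlock {n : ℕ} (N : ℕ → ℕ)
    (A : Matrix ((k : Fin n) × Fin (N k)) ((k : Fin n) × Fin (N k)) 𝔽) (c : ℕ) :
    Matrix {p : (k : Fin n) × Fin (N k) // (p.1 : ℕ) ≤ c}
      {p : (k : Fin n) × Fin (N k) // c < (p.1 : ℕ)} 𝔽 :=
  Matrix.of fun i j => A i.1 j.1

/-- The Hankel block `A_{S̄,S}` of a block matrix for a subset `S` of block indices. -/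
def blockHankel {n : ℕ} (N : ℕ → ℕ)
    (A : Matrix ((k : Fin n) × Fin (N k)) ((k : Fin n) × Fin (N k)) 𝔽) (S : Finset (Fin n)) :
    Matrix {p : (k : Fin n) × Fin (N k) // p.1 ∉ S}
      {p : (k : Fin n) × Fin (N k) // p.1 ∈ S} 𝔽 :=
  Matrix.of fun i j => A i.1 j.1

/-- `ρ_L(S)` for the line graph on `Fin n` with edges `{k, k+1}`: the number of edges with
exactly one endpoint in `S`. -/
def lineBorder (n : ℕ) (S : Finset (Fin n)) : ℕ :=
  (Finset.univ.filter fun p : Fin n × Fin n =>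
    (p.1 : ℕ) + 1 = (p.2 : ℕ) ∧ ¬((p.1 ∈ S) ↔ (p.2 ∈ S))).card

lemma sssChain_add (rg : ℕ → ℕ) (W : ∀ j, Matrix (Fin (rg j)) (Fin (rg (j + 1))) 𝔽) (k d : ℕ) :
    sssChain rg W k (k + d) = sssChainAux rg W k d := by
  have key : ∀ (e : ℕ) (_ : e = d) (h : k + e = k + d),
      (h ▸ sssChainAux rg W k e : Matrix (Fin (rg k)) (Fin (rg (k + d))) 𝔽) =
        sssChainAux rg W k d := by
    rintro e rfl h
    rfl
  rw [sssChain, dif_pos (Nat.le_add_right k d)]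
  exact key _ (Nat.add_sub_cancel_left ..) _

lemma sssChain_self (rg : ℕ → ℕ) (W : ∀ j, Matrix (Fin (rg j)) (Fin (rg (j + 1))) 𝔽) (k : ℕ) :
    sssChain rg W k k = 1 :=
  sssChain_add rg W k 0

lemma sssChain_succ (rg : ℕ → ℕ) (W : ∀ j, Matrix (Fin (rg j)) (Fin (rg (j + 1))) 𝔽)
    {k ℓ : ℕ} (h : k ≤ ℓ) : sssChain rg W k (ℓ + 1) = sssChain rg W k ℓ * W ℓ := by
  obtain ⟨d, rfl⟩ := Nat.exists_eq_add_of_le h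
  rw [sssChain_add]
  exact sssChain_add rg W k (d + 1)

lemma sssChain_mul_sssChain (rg : ℕ → ℕ) (W : ∀ j, Matrix (Fin (rg j)) (Fin (rg (j + 1))) 𝔽)
    {k c ℓ : ℕ} (hk : k ≤ c) (hc : c ≤ ℓ) :
    sssChain rg W k c * sssChain rg W c ℓ = sssChain rg W k ℓ := by
  induction ℓ, hc using Nat.le_induction with
  | base => rw [sssChain_self, Matrix.mul_one]
  | succ ℓ hc ih => rw [sssChain_succ rg W hc, sssChain_succ rg W (hk.trans hc),
      ← Matrix.mul_assoc, ih]

/-- A matrix of rank at most `r` factors through `Fin r → 𝔽`, with a left factor whose columns lie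
in the column space of the matrix. -/
lemma Matrix.exists_eq_mul_of_rank_le {m n : Type*} [Finite m] [Fintype n] [DecidableEq n]
    (G : Matrix m n 𝔽) {r : ℕ} (hr : G.rank ≤ r) :
    ∃ (X : Matrix m (Fin r) 𝔽) (Y : Matrix (Fin r) n 𝔽) (Z : Matrix n (Fin r) 𝔽),
      G = X * Y ∧ X = G * Z := by
  have hfin : Module.finrank 𝔽 (LinearMap.range G.mulVecLin) ≤ Module.finrank 𝔽 (Fin r → 𝔽) := by
    simpa [Matrix.rank] using hr
  obtain ⟨e, he⟩ := finrank_le_iff_exists_linearMap.1 hfin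
  obtain ⟨f, hf⟩ := e.exists_leftInverse_of_injective (LinearMap.ker_eq_bot.2 he)
  obtain ⟨s, hs⟩ := G.mulVecLin.rangeRestrict.exists_rightInverse_of_surjective
    (LinearMap.range_rangeRestrict _)
  have hG : ∀ v, G *ᵥ v = (G.mulVecLin.rangeRestrict v : m → 𝔽) := fun v => rfl
  refine ⟨LinearMap.toMatrix' ((LinearMap.range G.mulVecLin).subtype ∘ₗ f),
    LinearMap.toMatrix' (e ∘ₗ G.mulVecLin.rangeRestrict), LinearMap.toMatrix' (s ∘ₗ f), ?_, ?_⟩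
  · refine Matrix.ext_of_mulVec_single fun i => ?_
    rw [← Matrix.mulVec_mulVec, LinearMap.toMatrix'_mulVec, LinearMap.toMatrix'_mulVec, hG]
    exact congrArg Subtype.val (LinearMap.congr_fun hf _).symm
  · refine Matrix.ext_of_mulVec_single fun i => ?_
    rw [← Matrix.mulVec_mulVec, LinearMap.toMatrix'_mulVec, LinearMap.toMatrix'_mulVec, hG]
    exact congrArg Subtype.val (LinearMap.congr_fun hs _).symm

/-- The rank inequality of the nullity theorem: complementary off-diagonal blocks of the inverse
have rank at most that of the corresponding blocks of the matrix. -/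
lemma Matrix.rank_toBlock_inv_le {ι : Type*} [Fintype ι] [DecidableEq ι] {A : Matrix ι ι 𝔽}
    (hA : IsUnit A) (p q : ι → Prop) [DecidablePred q] (hpq : ∀ i, q i ↔ ¬ p i) :
    (A⁻¹.toBlock p q).rank ≤ (A.toBlock p q).rank := by
  have hinv : A⁻¹ * A = 1 := Matrix.nonsing_inv_mul A ((Matrix.isUnit_iff_isUnit_det A).1 hA)
  let ext : ({i // q i} → 𝔽) → ι → 𝔽 := fun v i => if h : q i then v ⟨i, h⟩ else 0
  have hext : ∀ (M : Matrix ι ι 𝔽) (v : {i // q i} → 𝔽) (i : ι),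
      (M *ᵥ ext v) i = ∑ j : {j // q j}, M i j * v j := by
    intro M v i
    have h₀ : ∑ j : {j // ¬ q j}, M i j * ext v j = 0 :=
      Finset.sum_eq_zero fun j _ => by simp [ext, j.2]
    have h₁ := Fintype.sum_subtype_add_sum_subtype q fun j => M i j * ext v j
    rw [h₀, add_zero] at h₁
    refine h₁.symm.trans (Fintype.sum_congr _ _ fun j => ?_)
    simp [ext, j.2]
  have hker : ∀ v ∈ LinearMap.ker (A.toBlock p q).mulVecLin,
      A *ᵥ ext v = ext ((A.toBlock q q) *ᵥ v) := by
    intro v hv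
    ext i
    rw [hext]
    by_cases hi : q i
    · simp [ext, hi, Matrix.mulVec, dotProduct, Matrix.toBlock_apply]
    · have hpi : p i := by_contra fun h => hi ((hpq i).2 h)
      have := congrFun (LinearMap.mem_ker.1 hv) ⟨i, hpi⟩
      simpa [ext, hi, Matrix.mulVec, dotProduct, Matrix.toBlock_apply] using this
  have hback : ∀ v ∈ LinearMap.ker (A.toBlock p q).mulVecLin,
      A⁻¹ *ᵥ ext ((A.toBlock q q) *ᵥ v) = ext v := by
    intro v hv
    rw [← hker v hv, Matrix.mulVec_mulVec, hinv, Matrix.one_mulVec]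
  have hmaps : ∀ v ∈ LinearMap.ker (A.toBlock p q).mulVecLin,
      (A.toBlock q q).mulVecLin v ∈ LinearMap.ker (A⁻¹.toBlock p q).mulVecLin := by
    intro v hv
    rw [LinearMap.mem_ker]
    ext i
    have := congrFun (hback v hv) i
    have hi : ¬ q i := fun h => (hpq i).1 h i.2
    rw [hext] at this
    simpa [ext, hi, Matrix.mulVec, dotProduct, Matrix.toBlock_apply] using this
  have hinj : Function.Injective ((A.toBlock q q).mulVecLin.restrict hmaps) := by
    intro v w hvw
    have hvw' : A.toBlock q q *ᵥ v = A.toBlock q q *ᵥ w := congrArg Subtype.val hvw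
    have h := (hback v v.2).symm.trans ((congrArg (fun x => A⁻¹ *ᵥ ext x) hvw').trans (hback w w.2))
    ext i
    simpa [ext, i.2] using congrFun h i
  have h₁ := LinearMap.finrank_le_finrank_of_injective hinj
  have h₂ := (A.toBlock p q).mulVecLin.finrank_range_add_finrank_ker
  have h₃ := (A⁻¹.toBlock p q).mulVecLin.finrank_range_add_finrank_ker
  rw [Matrix.rank, Matrix.rank]
  omega

section UpperHankel

variable {n : ℕ} (N : ℕ → ℕ) (A : Matrix ((k : Fin n) × Fin (N k)) ((k : Fin n) × Fin (N k)) 𝔽)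
  (rg : ℕ → ℕ)

lemma rank_upperHankelBlock_le
    (U : ∀ k, Matrix (Fin (N k)) (Fin (rg k)) 𝔽)
    (W : ∀ j, Matrix (Fin (rg j)) (Fin (rg (j + 1))) 𝔽)
    (V : ∀ k, Matrix (Fin (N k)) (Fin (rg (k - 1))) 𝔽)
    (h : ∀ (k ℓ : Fin n), (k : ℕ) < (ℓ : ℕ) → ∀ (i : Fin (N k)) (j : Fin (N ℓ)),
      A ⟨k, i⟩ ⟨ℓ, j⟩ = (U k * sssChain rg W k ((ℓ : ℕ) - 1) * (V ℓ)ᵀ) i j) (c : ℕ) :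
    (upperHankelBlock N A c).rank ≤ rg c := by
  have hfac : upperHankelBlock N A c =
      (Matrix.of fun (p : {p : (k : Fin n) × Fin (N k) // (p.1 : ℕ) ≤ c}) s =>
        (U p.1.1 * sssChain rg W p.1.1 c) p.1.2 s) *
        Matrix.of fun s (q : {p : (k : Fin n) × Fin (N k) // c < (p.1 : ℕ)}) =>
          (sssChain rg W c (q.1.1 - 1) * (V q.1.1)ᵀ) s q.1.2 := by
    ext ⟨⟨k, i⟩, hk⟩ ⟨⟨ℓ, j⟩, hℓ⟩
    have hk : (k : ℕ) ≤ c := hk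
    have hℓ : c < (ℓ : ℕ) := hℓ
    change A ⟨k, i⟩ ⟨ℓ, j⟩ = ((U k * sssChain rg W k c) *
      (sssChain rg W c (ℓ - 1) * (V ℓ)ᵀ)) i j
    rw [h k ℓ (by omega), ← sssChain_mul_sssChain rg W hk (by omega : c ≤ (ℓ : ℕ) - 1)]
    simp only [Matrix.mul_assoc]
  rw [hfac]
  exact (Matrix.rank_mul_le_left _ _).trans
    ((Matrix.rank_le_card_width _).trans_eq (Fintype.card_fin _))

lemma exists_upper_rep_of_rank_le (h : ∀ c, (upperHankelBlock N A c).rank ≤ rg c) :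
    ∃ (U : ∀ k, Matrix (Fin (N k)) (Fin (rg k)) 𝔽)
      (W : ∀ j, Matrix (Fin (rg j)) (Fin (rg (j + 1))) 𝔽)
      (V : ∀ k, Matrix (Fin (N k)) (Fin (rg (k - 1))) 𝔽),
      ∀ (k ℓ : Fin n), (k : ℕ) < (ℓ : ℕ) → ∀ (i : Fin (N k)) (j : Fin (N ℓ)),
        A ⟨k, i⟩ ⟨ℓ, j⟩ = (U k * sssChain rg W k ((ℓ : ℕ) - 1) * (V ℓ)ᵀ) i j := by
  choose X Y Z hXY hXZ using fun c : ℕ => Matrix.exists_eq_mul_of_rank_le _ (h c)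
  let U : ∀ k, Matrix (Fin (N k)) (Fin (rg k)) 𝔽 := fun k => Matrix.of fun i s =>
    if hk : k < n then X k ⟨⟨⟨k, hk⟩, i⟩, le_rfl⟩ s else 0
  let V : ∀ k, Matrix (Fin (N k)) (Fin (rg (k - 1))) 𝔽 := fun k => Matrix.of fun j s =>
    if hk : k - 1 < k ∧ k < n then Y (k - 1) s ⟨⟨⟨k, hk.2⟩, j⟩, hk.1⟩ else 0
  let W : ∀ j, Matrix (Fin (rg j)) (Fin (rg (j + 1))) 𝔽 := fun c =>
    (Y c).submatrix id (fun q => ⟨q.1, (Nat.lt_succ_self c).trans q.2⟩) * Z (c + 1)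
  have hstep : ∀ c p (hp : (p.1 : ℕ) ≤ c),
      X (c + 1) ⟨p, hp.trans (Nat.le_succ c)⟩ = (X c * W c) ⟨p, hp⟩ := by
    intro c p hp
    have hsub : (upperHankelBlock N A (c + 1)).submatrix
        (fun p : {p : (k : Fin n) × Fin (N k) // (p.1 : ℕ) ≤ c} =>
          ⟨p.1, p.2.trans (Nat.le_succ c)⟩) id =
        X c * (Y c).submatrix id (fun q => ⟨q.1, (Nat.lt_succ_self c).trans q.2⟩) := by
      ext p q
      exact congrFun (congrFun (hXY c) p) ⟨q.1, (Nat.lt_succ_self c).trans q.2⟩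
    have hW : X c * W c = (upperHankelBlock N A (c + 1)).submatrix
        (fun p : {p : (k : Fin n) × Fin (N k) // (p.1 : ℕ) ≤ c} =>
          ⟨p.1, p.2.trans (Nat.le_succ c)⟩) id * Z (c + 1) := by
      rw [hsub, Matrix.mul_assoc]
      rfl
    rw [hW]
    exact congrFun (hXZ (c + 1)) _
  have hchain : ∀ (k : Fin n) (i : Fin (N k)) (m : ℕ) (hm : (k : ℕ) ≤ m),
      X m ⟨⟨k, i⟩, hm⟩ = (U k * sssChain rg W k m) i := by
    intro k i m hm
    induction m, hm using Nat.le_induction with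
    | base =>
      rw [sssChain_self, Matrix.mul_one]
      ext s
      simp [U]
    | succ m hm ih =>
      rw [hstep m ⟨k, i⟩ hm, sssChain_succ rg W hm, ← Matrix.mul_assoc,
        Matrix.mul_apply_eq_vecMul, Matrix.mul_apply_eq_vecMul, ih]
  refine ⟨U, W, V, fun k ℓ hkℓ i j => ?_⟩
  have hlt : (ℓ : ℕ) - 1 < ℓ := by omega
  have hA := congrFun (congrFun (hXY (ℓ - 1)) ⟨⟨k, i⟩, Nat.le_sub_one_of_lt hkℓ⟩) ⟨⟨ℓ, j⟩, hlt⟩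
  refine hA.trans ?_
  simp only [Matrix.mul_apply (M := X _), hchain k i _ (Nat.le_sub_one_of_lt hkℓ)]
  rw [Matrix.mul_apply]
  have hℓ : (ℓ : ℕ) ≠ 0 := by omega
  simp [V, hℓ]

lemma exists_upper_rep_inv (hA : IsUnit A)
    (U : ∀ k, Matrix (Fin (N k)) (Fin (rg k)) 𝔽)
    (W : ∀ j, Matrix (Fin (rg j)) (Fin (rg (j + 1))) 𝔽)
    (V : ∀ k, Matrix (Fin (N k)) (Fin (rg (k - 1))) 𝔽)
    (h : ∀ (k ℓ : Fin n), (k : ℕ) < (ℓ : ℕ) → ∀ (i : Fin (N k)) (j : Fin (N ℓ)),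
      A ⟨k, i⟩ ⟨ℓ, j⟩ = (U k * sssChain rg W k ((ℓ : ℕ) - 1) * (V ℓ)ᵀ) i j) :
    ∃ (U' : ∀ k, Matrix (Fin (N k)) (Fin (rg k)) 𝔽)
      (W' : ∀ j, Matrix (Fin (rg j)) (Fin (rg (j + 1))) 𝔽)
      (V' : ∀ k, Matrix (Fin (N k)) (Fin (rg (k - 1))) 𝔽),
      ∀ (k ℓ : Fin n), (k : ℕ) < (ℓ : ℕ) → ∀ (i : Fin (N k)) (j : Fin (N ℓ)),
        A⁻¹ ⟨k, i⟩ ⟨ℓ, j⟩ = (U' k * sssChain rg W' k ((ℓ : ℕ) - 1) * (V' ℓ)ᵀ) i j :=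
  exists_upper_rep_of_rank_le N A⁻¹ rg fun c =>
    (Matrix.rank_toBlock_inv_le hA (fun p => (p.1 : ℕ) ≤ c) (fun p => c < (p.1 : ℕ))
      fun _ => not_le.symm).trans (rank_upperHankelBlock_le N A rg U W V h c)

end UpperHankel

/-- If an invertible block matrix `A` admits an SSS representation with
dimensions `rh`, `rg`, then `A⁻¹` admits an SSS representation with exactly the same
dimensions. -/
theorem sss_inv {n : ℕ} (N : ℕ → ℕ)
    (A : Matrix ((k : Fin n) × Fin (N k)) ((k : Fin n) × Fin (N k)) 𝔽)
    (hA : IsUnit A)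
    (rg rh : ℕ → ℕ)
    (U : ∀ k, Matrix (Fin (N k)) (Fin (rg k)) 𝔽)
    (W : ∀ j, Matrix (Fin (rg j)) (Fin (rg (j + 1))) 𝔽)
    (V : ∀ k, Matrix (Fin (N k)) (Fin (rg (k - 1))) 𝔽)
    (D : ∀ k, Matrix (Fin (N k)) (Fin (N k)) 𝔽)
    (P : ∀ k, Matrix (Fin (N k)) (Fin (rh (k - 1))) 𝔽)
    (R : ∀ j, Matrix (Fin (rh (j + 1))) (Fin (rh j)) 𝔽)
    (Q : ∀ k, Matrix (Fin (N k)) (Fin (rh k)) 𝔽)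
    (h : IsSSSRep N A rg rh U W V D P R Q) :
    ∃ (U' : ∀ k, Matrix (Fin (N k)) (Fin (rg k)) 𝔽)
      (W' : ∀ j, Matrix (Fin (rg j)) (Fin (rg (j + 1))) 𝔽)
      (V' : ∀ k, Matrix (Fin (N k)) (Fin (rg (k - 1))) 𝔽)
      (D' : ∀ k, Matrix (Fin (N k)) (Fin (N k)) 𝔽)
      (P' : ∀ k, Matrix (Fin (N k)) (Fin (rh (k - 1))) 𝔽)
      (R' : ∀ j, Matrix (Fin (rh (j + 1))) (Fin (rh j)) 𝔽)
      (Q' : ∀ k, Matrix (Fin (N k)) (Fin (rh k)) 𝔽),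
      IsSSSRep N A⁻¹ rg rh U' W' V' D' P' R' Q' := by
  obtain ⟨-, hupper, hlower⟩ := h
  obtain ⟨U', W', V', hU⟩ := exists_upper_rep_inv N A rg hA U W V hupper
  obtain ⟨Q', S', P', hL⟩ := exists_upper_rep_inv N Aᵀ rh ((Matrix.isUnit_transpose A).2 hA)
    Q (fun j => (R j)ᵀ) P fun k ℓ hkℓ i j => by
      rw [Matrix.transpose_apply, hlower ℓ k hkℓ, ← Matrix.transpose_apply (M := _ * _)]
      simp only [Matrix.transpose_mul, Matrix.transpose_transpose, Matrix.mul_assoc]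
  refine ⟨U', W', V', fun k => Matrix.of fun i j =>
      if hk : k < n then A⁻¹ ⟨⟨k, hk⟩, i⟩ ⟨⟨k, hk⟩, j⟩ else 0,
    P', fun j => (S' j)ᵀ, Q', fun k i j => by simp, hU, fun k ℓ hℓk i j => ?_⟩
  have h := hL ℓ k hℓk j i
  rw [← Matrix.transpose_nonsing_inv, Matrix.transpose_apply] at h
  rw [h, ← Matrix.transpose_apply (M := _ * _)]
  simp only [Matrix.transpose_mul, Matrix.transpose_transpose, Matrix.mul_assoc]
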